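/- (Evaluation of complete quadratic sums) Let q be odd, G(x) = Σ_{i=1}^d α_i x_i² a diagonal quadratic form modulo r with each α_i invertible mod r, c, c' ∈ (F_q[t]/(r))^d, e ∈ F_q[t]/(r). Then S_r(G,c,c',e) = τ_r^d (D/r) ψ(Σ_j (2α_j)^{-1} c_j c_j' / r) · Σ*_{|a|<|r|} (a/r)^d ψ( (a(e − Σ_j (4α_j)^{-1} c_j'²) − ā Σ_j (4α_j)^{-1} c_j²) / r ), where τ_r = Σ_{|x|<|r|} ψ(x²/r) is the Gauss sum, D = Π α_j, (·/·) is the Jacobi symbol, and ā is the inverse of a mod r. -/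

import Mathlib

/-!
Common setup: `K_∞ = 𝔽_q((1/t))` is modeled as `LaurentSeries Fq` in the variable `X = 1/t`,
so that an element `Σ_{i ≤ N} a_i t^i` of `K_∞` corresponds to the Hahn series
`Σ_{n ≥ -N} a_{-n} X^n`.  The degree in `t` is the negative of the Hahn-series order,
the absolute value is `|α| = q^{deg_t α}`, and the standard additive character is
`ψ(α) = e_q(coefficient of t^{-1}) = e_q(coefficient of X^1)`.
-/

open scoped BigOperators Classical
noncomputable section



namespace FF

variable {Fq : Type*} [Field Fq] [Fintype Fq]

/-- The element `t = X⁻¹` of `K_∞`. -/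
def tK : LaurentSeries Fq := HahnSeries.single (-1 : ℤ) 1

/-- Degree in `t` of a Laurent series (degree of `0` is `0` by convention). -/
def tdeg (α : LaurentSeries Fq) : ℤ := -α.order

/-- The absolute value `|α| = q^{deg_t α}` on `K_∞`, with `|0| = 0`. -/
def absv (α : LaurentSeries Fq) : ℝ :=
  if α = 0 then 0 else (Fintype.card Fq : ℝ) ^ (-α.order)

/-- The embedding `𝔽_q[t] → K_∞`. -/
def toK (p : Polynomial Fq) : LaurentSeries Fq := Polynomial.eval₂ HahnSeries.C tK p

/-- The standard additive character `ψ` of `K_∞` attached to a character `e` of `𝔽_q`. -/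
def psi (e : AddChar Fq ℂ) (α : LaurentSeries Fq) : ℂ := e (α.coeff 1)

/-- The polynomial `Σ_{i<N} c_i t^i` attached to a coefficient tuple. -/
def polyOf {N : ℕ} (c : Fin N → Fq) : Polynomial Fq :=
  ∑ i : Fin N, Polynomial.C (c i) * Polynomial.X ^ (i : ℕ)

/-- Absolute value of a polynomial: `|p| = q^{deg p}`, `|0| = 0`. -/
def absP (p : Polynomial Fq) : ℝ :=
  if p = 0 then 0 else (Fintype.card Fq : ℝ) ^ p.natDegree

/-- The part `((γ))` of `γ` supported in strictly negative `t`-degrees. -/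
def fracPart (γ : LaurentSeries Fq) : LaurentSeries Fq where
  coeff n := if 1 ≤ n then γ.coeff n else 0
  isPWO_support' := γ.isPWO_support'.mono (fun n hn => by
    by_cases h : (1 : ℤ) ≤ n <;> simp_all [Function.support])

/-- A canonical choice of inverse of `x` modulo `c` (junk value `0` if not coprime). -/
def modInv (x c : Polynomial Fq) : Polynomial Fq :=
  if h : IsCoprime x c then h.choose else 0

/-- Riemann sums approximating the Haar integral (normalized by `μ(𝕋) = 1`) of `w`
over the ball `{|α| < q^Y}`, at resolution `M`: the ball is partitioned into `q^M`
sub-balls of measure `q^{Y-M}` with representatives `Σ_{0 ≤ j < M} c_j t^{Y-1-j}`. -/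
def ballSum (Y : ℤ) (M : ℕ) (w : LaurentSeries Fq → ℂ) : ℂ :=
  ((Fintype.card Fq : ℂ) ^ Y * ((Fintype.card Fq : ℂ) ^ M)⁻¹) *
    ∑ c : Fin M → Fq, w (∑ j : Fin M, HahnSeries.single ((1 : ℤ) - Y + (j : ℕ)) (c j))

/-- Riemann sums approximating the Haar integral of `w` over `𝕋^d` at resolution `M`. -/
def cubeSum (d M : ℕ) (w : (Fin d → LaurentSeries Fq) → ℂ) : ℂ :=
  (((Fintype.card Fq : ℂ) ^ (d * M))⁻¹) *
    ∑ c : Fin d → Fin M → Fq,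
      w (fun i => ∑ j : Fin M, HahnSeries.single (((j : ℕ) : ℤ) + 1) (c i j))

end FF

namespace FF
variable {Fq : Type*} [Field Fq] [Fintype Fq]

/-- The complete quadratic exponential sum
`S_r(G,c,c',e₀) = Σ*_{|a|<|r|} Σ_{b mod r} ψ((a(G(b) + ⟨c',b⟩ + e₀) − ⟨c,b⟩)/r)`
attached to the quadratic form `G(x) = xᵀBx`; residues `a` and the coordinates of `b`
modulo `r` are enumerated by coefficient tuples of length `deg r`, and `Σ*` restricts to
`a` coprime to `r`. -/
def quadSum {d : ℕ} (e : AddChar Fq ℂ) (B : Matrix (Fin d) (Fin d) (Polynomial Fq))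
    (r : Polynomial Fq) (c c' : Fin d → Polynomial Fq) (e₀ : Polynomial Fq) : ℂ :=
  ∑ a : Fin r.natDegree → Fq, ∑ b : Fin d → Fin r.natDegree → Fq,
    if IsCoprime (polyOf a) r then
      psi e (toK (polyOf a * ((∑ i, ∑ j, polyOf (b i) * B i j * polyOf (b j)) +
          (∑ i, c' i * polyOf (b i)) + e₀) - ∑ i, c i * polyOf (b i)) / toK r)
    else 0

end FF

namespace FF
variable {Fq : Type*} [Field Fq] [Fintype Fq]

/-- The Jacobi symbol `(x/c)` for `𝔽_q[t]`: the product, over the irreducible factors `p`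
of `c` (with multiplicity), of the quadratic residue symbol of `x` modulo `p`. -/
def jacobiP (x c : Polynomial Fq) : ℂ :=
  ((UniqueFactorizationMonoid.factors c).map (fun p =>
    if p ∣ x then (0 : ℂ) else if ∃ y : Polynomial Fq, p ∣ (y * y - x) then 1 else -1)).prod

/-- The Gauss sum `τ_r = Σ_{|x|<|r|} ψ(x²/r)`. -/
def gaussP (e : AddChar Fq ℂ) (r : Polynomial Fq) : ℂ :=
  ∑ x : Fin r.natDegree → Fq, psi e (toK (polyOf x * polyOf x) / toK r)

end FF

namespace FF
open Polynomial

section FractionalCharacter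

variable {Fq : Type*} [Field Fq]

lemma coeff_toK (p : Fq[X]) (k : ℤ) :
    (toK p).coeff k = if k ≤ 0 then p.coeff (-k).toNat else 0 := by
  induction p using Polynomial.induction_on' with
  | add p q hp hq =>
    have : toK (p + q) = toK p + toK q := Polynomial.eval₂_add _ _
    rw [this, HahnSeries.coeff_add, hp, hq]
    split_ifs <;> simp
  | monomial n a =>
    have : toK (monomial n a) = HahnSeries.single (-(n : ℤ)) a := by
      rw [toK, eval₂_monomial, tK, HahnSeries.single_pow, HahnSeries.C_apply]
      simp [HahnSeries.single_mul_single]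
    rw [this, HahnSeries.coeff_single, coeff_monomial]
    split_ifs <;> first | rfl | (exfalso; omega)

lemma toK_add (p q : Fq[X]) : toK (p + q) = toK p + toK q := Polynomial.eval₂_add _ _

lemma toK_mul (p q : Fq[X]) : toK (p * q) = toK p * toK q := Polynomial.eval₂_mul _ _

lemma toK_ne_zero {p : Fq[X]} (hp : p ≠ 0) : toK p ≠ 0 := by
  intro h
  have := coeff_toK p (-(p.natDegree : ℤ))
  rw [h] at this
  exact hp (by simpa using this.symm)

lemma order_toK {p : Fq[X]} (hp : p ≠ 0) : (toK p).order = -(p.natDegree : ℤ) := by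
  apply le_antisymm
  · apply HahnSeries.order_le_of_coeff_ne_zero
    simp [coeff_toK, hp]
  · rw [HahnSeries.le_order_iff_forall (toK_ne_zero hp)]
    intro j hj
    rw [coeff_toK, if_pos (by omega)]
    exact coeff_eq_zero_of_natDegree_lt (by omega)

/-- The additive character `p ↦ ψ(p / r)` of `𝔽_q[t]`. -/
def fracChar (e : AddChar Fq ℂ) (r : Fq[X]) : AddChar Fq[X] ℂ where
  toFun p := psi e (toK p / toK r)
  map_zero_eq_one' := by simp [psi, toK]
  map_add_eq_mul' p q := by
    simp [psi, toK_add, add_div, AddChar.map_add_eq_mul]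

lemma fracChar_apply (e : AddChar Fq ℂ) (r p : Fq[X]) :
    fracChar e r p = psi e (toK p / toK r) := rfl

lemma fracChar_of_dvd (e : AddChar Fq ℂ) {r p : Fq[X]} (hr : r ≠ 0) (h : r ∣ p) :
    fracChar e r p = 1 := by
  obtain ⟨s, rfl⟩ := h
  rw [fracChar_apply, toK_mul, mul_div_cancel_left₀ _ (toK_ne_zero hr), psi, coeff_toK]
  simp

lemma fracChar_congr (e : AddChar Fq ℂ) {r p p' : Fq[X]} (hr : r ≠ 0) (h : r ∣ p - p') :
    fracChar e r p = fracChar e r p' := by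
  rw [← sub_add_cancel p p', AddChar.map_add_eq_mul, fracChar_of_dvd e hr h, one_mul]

lemma fracChar_mul_mul (e : AddChar Fq ℂ) {s : Fq[X]} (hs : s ≠ 0) (r p : Fq[X]) :
    fracChar e (s * r) (s * p) = fracChar e r p := by
  rw [fracChar_apply, fracChar_apply, toK_mul, toK_mul, mul_div_mul_left _ _ (toK_ne_zero hs)]

lemma exists_fracChar_ne_one {e : AddChar Fq ℂ} (he : e ≠ 1) {r : Fq[X]}
    (hr : 0 < r.natDegree) : ∃ b, fracChar e r b ≠ 1 := by
  have hr0 : r ≠ 0 := by rintro rfl; simp at hr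
  obtain ⟨x, hx⟩ := AddChar.ne_one_iff.1 he
  set L := toK (X ^ (r.natDegree - 1)) / toK r with hL
  have hX : (X ^ (r.natDegree - 1) : Fq[X]) ≠ 0 := pow_ne_zero _ X_ne_zero
  have hL0 : L ≠ 0 := div_ne_zero (toK_ne_zero hX) (toK_ne_zero hr0)
  have hord : L.order = 1 := by
    have h1 : (L * toK r).order = L.order + (toK r).order :=
      HahnSeries.order_mul hL0 (toK_ne_zero hr0)
    rw [hL, div_mul_cancel₀ _ (toK_ne_zero hr0), ← hL, order_toK hX, order_toK hr0,
      natDegree_X_pow] at h1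
    omega
  have hc : L.coeff 1 ≠ 0 := by
    rw [← hord]
    exact fun h => hL0 (HahnSeries.coeff_order_eq_zero.1 h)
  refine ⟨C (x / L.coeff 1) * X ^ (r.natDegree - 1), ?_⟩
  have hC : toK (C (x / L.coeff 1)) = HahnSeries.C (x / L.coeff 1) := eval₂_C _ _
  rw [fracChar_apply, toK_mul, mul_div_assoc, ← hL, hC, psi, HahnSeries.C_mul_eq_smul,
    HahnSeries.coeff_smul, smul_eq_mul, div_mul_cancel₀ _ hc]
  exact hx

end FractionalCharacter

section CompleteResidues

variable {Fq : Type*} [Field Fq]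

lemma coeff_polyOf {N : ℕ} (c : Fin N → Fq) (i : Fin N) : (polyOf c).coeff i = c i := by
  simp only [polyOf, finsetSum_coeff, coeff_C_mul, coeff_X_pow, mul_ite, mul_one, mul_zero]
  rw [Finset.sum_eq_single i] <;> simp +contextual [Fin.val_inj, eq_comm]

lemma degree_polyOf_lt {N : ℕ} (c : Fin N → Fq) : (polyOf c).degree < N := by
  refine (degree_sum_le _ _).trans_lt ?_
  refine (Finset.sup_lt_iff (WithBot.bot_lt_coe N)).2 fun i _ => (degree_C_mul_X_pow_le _ _).trans_lt (WithBot.coe_lt_coe.2 i.2)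

lemma polyOf_coeff {N : ℕ} {p : Fq[X]} (hp : p.degree < N) :
    polyOf (fun i : Fin N => p.coeff i) = p := by
  ext n
  by_cases h : n < N
  · exact coeff_polyOf (fun i : Fin N => p.coeff i) ⟨n, h⟩
  · push Not at h
    rw [coeff_eq_zero_of_degree_lt ((degree_polyOf_lt _).trans_le (by exact_mod_cast h)),
      coeff_eq_zero_of_degree_lt (hp.trans_le (by exact_mod_cast h))]

lemma polyOf_injective {N : ℕ} : Function.Injective (polyOf : (Fin N → Fq) → Fq[X]) :=
  fun c c' h => funext fun i => by rw [← coeff_polyOf c i, h, coeff_polyOf]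

lemma eq_of_dvd_polyOf_sub {r : Fq[X]} (hr : r ≠ 0) {x y : Fin r.natDegree → Fq}
    (h : r ∣ polyOf x - polyOf y) : x = y := by
  apply polyOf_injective
  rw [← sub_eq_zero]
  refine eq_zero_of_dvd_of_degree_lt h ?_
  rw [degree_eq_natDegree hr]
  exact (degree_sub_le _ _).trans_lt (max_lt (degree_polyOf_lt _) (degree_polyOf_lt _))

lemma exists_dvd_sub_polyOf {r : Fq[X]} (hr : r ≠ 0) (p : Fq[X]) :
    ∃ x : Fin r.natDegree → Fq, r ∣ p - polyOf x := by
  refine ⟨fun i => (p % r).coeff i, ?_⟩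
  rw [polyOf_coeff (by rw [← degree_eq_natDegree hr]; exact degree_mod_lt p hr)]
  exact ⟨p / r, by rw [sub_eq_iff_eq_add, EuclideanDomain.div_add_mod]⟩

/-- A sum of an `r`-periodic function does not depend on the complete residue system. -/
lemma sum_polyOf_eq_sum [Fintype Fq] {ι : Type*} [Fintype ι] {r : Fq[X]} (hr : r ≠ 0) (φ : ι → Fq[X])
    (hcard : Fintype.card ι = Fintype.card Fq ^ r.natDegree)
    (hinj : ∀ i j, r ∣ φ i - φ j → i = j) (f : Fq[X] → ℂ)
    (hf : ∀ x y, r ∣ x - y → f x = f y) :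
    ∑ x : Fin r.natDegree → Fq, f (polyOf x) = ∑ i, f (φ i) := by
  choose g hg using fun i => exists_dvd_sub_polyOf hr (φ i)
  have hginj : Function.Injective g := fun i j hij => hinj i j <| by
    have := dvd_sub (hg i) (hg j)
    rwa [hij, sub_sub_sub_cancel_right] at this
  have hgbij : Function.Bijective g :=
    (Fintype.bijective_iff_injective_and_card g).2 ⟨hginj, by simp [hcard]⟩
  exact (Fintype.sum_bijective g hgbij _ _ fun i => hf _ _ (hg i)).symm

lemma sum_polyOf_affine [Fintype Fq] {r u : Fq[X]} (hr : r ≠ 0) (hu : IsCoprime u r) (v : Fq[X])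
    (f : Fq[X] → ℂ) (hf : ∀ x y, r ∣ x - y → f x = f y) :
    ∑ x : Fin r.natDegree → Fq, f (polyOf x) =
      ∑ x : Fin r.natDegree → Fq, f (u * polyOf x + v) := by
  refine sum_polyOf_eq_sum hr _ (by simp) (fun i j h => ?_) f hf
  rw [add_sub_add_right_eq_sub, ← mul_sub] at h
  exact eq_of_dvd_polyOf_sub hr (hu.symm.dvd_of_dvd_mul_left h)

lemma sum_fracChar_eq_zero [Fintype Fq] {e : AddChar Fq ℂ} (he : e ≠ 1) {r : Fq[X]}
    (hr : 0 < r.natDegree) : ∑ z : Fin r.natDegree → Fq, fracChar e r (polyOf z) = 0 := by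
  have hr0 : r ≠ 0 := by rintro rfl; simp at hr
  obtain ⟨b, hb⟩ := exists_fracChar_ne_one he hr
  have h := sum_polyOf_affine hr0 isCoprime_one_left b (fracChar e r)
    (fun _ _ => fracChar_congr e hr0)
  simp only [one_mul, AddChar.map_add_eq_mul, ← Finset.sum_mul] at h
  exact eq_zero_of_mul_eq_self_right hb h.symm

lemma sum_fracChar_mul_eq_zero [Fintype Fq] {e : AddChar Fq ℂ} (he : e ≠ 1) {r b : Fq[X]}
    (hr : 0 < r.natDegree) (hb : IsCoprime b r) :
    ∑ z : Fin r.natDegree → Fq, fracChar e r (b * polyOf z) = 0 := by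
  have hr0 : r ≠ 0 := by rintro rfl; simp at hr
  rw [← sum_fracChar_eq_zero he hr,
    sum_polyOf_affine hr0 hb 0 (fracChar e r) (fun _ _ => fracChar_congr e hr0)]
  simp

end CompleteResidues

section ResidueSymbol

variable {Fq : Type*} [Field Fq]

/-- The quadratic residue symbol of `x` modulo `p`. -/
def residueSymbol (p x : Fq[X]) : ℂ :=
  if p ∣ x then 0 else if ∃ y : Fq[X], p ∣ (y * y - x) then 1 else -1

lemma finite_adjoinRoot [Fintype Fq] {p : Fq[X]} (hp : p ≠ 0) : Finite (AdjoinRoot p) :=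
  Finite.of_surjective (fun x : Fin p.natDegree → Fq => AdjoinRoot.mk p (polyOf x)) fun k => by
    obtain ⟨b, rfl⟩ := AdjoinRoot.mk_surjective k
    obtain ⟨x, hx⟩ := exists_dvd_sub_polyOf hp b
    exact ⟨x, (AdjoinRoot.mk_eq_mk.2 hx).symm⟩

lemma residueSymbol_eq_quadraticChar {p : Fq[X]} [Fact (Irreducible p)]
    [Fintype (AdjoinRoot p)] (x : Fq[X]) :
    residueSymbol p x = (quadraticChar (AdjoinRoot p) (AdjoinRoot.mk p x) : ℤ) := by
  have h1 : AdjoinRoot.mk p x = 0 ↔ p ∣ x := AdjoinRoot.mk_eq_zero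
  have h2 : IsSquare (AdjoinRoot.mk p x) ↔ ∃ y : Fq[X], p ∣ (y * y - x) := by
    constructor
    · rintro ⟨k, hk⟩
      obtain ⟨y, rfl⟩ := AdjoinRoot.mk_surjective k
      exact ⟨y, AdjoinRoot.mk_eq_mk.1 (by rw [hk, map_mul])⟩
    · rintro ⟨y, hy⟩
      exact ⟨AdjoinRoot.mk p y, by rw [← map_mul, AdjoinRoot.mk_eq_mk.2 hy]⟩
  rw [quadraticChar_apply, quadraticCharFun, residueSymbol]
  simp only [h1, h2]
  split_ifs <;> simp

lemma residueSymbol_mul [Fintype Fq] {p : Fq[X]} (hp : Irreducible p) (x y : Fq[X]) :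
    residueSymbol p (x * y) = residueSymbol p x * residueSymbol p y := by
  have := Fact.mk hp
  have := finite_adjoinRoot hp.ne_zero
  have := Fintype.ofFinite (AdjoinRoot p)
  simp only [residueSymbol_eq_quadraticChar, map_mul, Int.cast_mul]

lemma residueSymbol_mul_self {p x : Fq[X]} (hx : ¬ p ∣ x) :
    residueSymbol p x * residueSymbol p x = 1 := by
  rw [residueSymbol, if_neg hx]
  split_ifs <;> norm_num

lemma residueSymbol_associated {p p' : Fq[X]} (h : Associated p p') (x : Fq[X]) :
    residueSymbol p x = residueSymbol p' x := by
  simp only [residueSymbol, h.dvd_iff_dvd_left]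

lemma jacobiP_eq_prod (x r : Fq[X]) :
    jacobiP x r =
      ((UniqueFactorizationMonoid.factors r).map fun p => residueSymbol p x).prod := rfl

lemma prod_map_residueSymbol_of_rel {s t : Multiset Fq[X]} (h : s.Rel Associated t)
    (x : Fq[X]) :
    (s.map fun p => residueSymbol p x).prod = (t.map fun p => residueSymbol p x).prod := by
  induction h with
  | zero => rfl
  | cons hab _ ih => simp only [Multiset.map_cons, Multiset.prod_cons, ih,
      residueSymbol_associated hab]

lemma jacobiP_mul_right (x : Fq[X]) {r s : Fq[X]} (hr : r ≠ 0) (hs : s ≠ 0) :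
    jacobiP x (r * s) = jacobiP x r * jacobiP x s := by
  simp only [jacobiP_eq_prod]
  rw [prod_map_residueSymbol_of_rel (UniqueFactorizationMonoid.factors_mul hr hs) x,
    Multiset.map_add, Multiset.prod_add]

lemma jacobiP_of_irreducible (x : Fq[X]) {p : Fq[X]} (hp : Irreducible p) :
    jacobiP x p = residueSymbol p x := by
  obtain ⟨p', h, hp'⟩ := prime_factors_irreducible hp
    ⟨UniqueFactorizationMonoid.prime_of_factor,
      UniqueFactorizationMonoid.factors_prod hp.ne_zero⟩
  rw [jacobiP_eq_prod, hp', Multiset.map_singleton, Multiset.prod_singleton,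
    residueSymbol_associated h]

lemma jacobiP_of_isUnit (x : Fq[X]) {r : Fq[X]} (hr : IsUnit r) : jacobiP x r = 1 := by
  rw [jacobiP_eq_prod, UniqueFactorizationMonoid.factors_of_isUnit hr]
  simp

lemma jacobiP_mul_left [Fintype Fq] (x y r : Fq[X]) :
    jacobiP (x * y) r = jacobiP x r * jacobiP y r := by
  simp only [jacobiP_eq_prod]
  rw [← Multiset.prod_map_mul]
  refine congrArg _ (Multiset.map_congr rfl fun p hp => ?_)
  exact residueSymbol_mul (UniqueFactorizationMonoid.irreducible_of_factor p hp) x y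

lemma jacobiP_one_left (r : Fq[X]) : jacobiP 1 r = 1 := by
  rw [jacobiP_eq_prod]
  refine Multiset.prod_eq_one fun z hz => ?_
  obtain ⟨p, hp, rfl⟩ := Multiset.mem_map.1 hz
  have hp1 := (UniqueFactorizationMonoid.irreducible_of_factor p hp).not_isUnit
  rw [residueSymbol, if_neg fun h => hp1 (isUnit_of_dvd_one h), if_pos ⟨1, by simp⟩]

lemma jacobiP_prod_left [Fintype Fq] {ι : Type*} (s : Finset ι) (x : ι → Fq[X]) (r : Fq[X]) :
    jacobiP (∏ j ∈ s, x j) r = ∏ j ∈ s, jacobiP (x j) r :=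
  map_prod (⟨⟨fun x => jacobiP x r, jacobiP_one_left r⟩, fun x y => jacobiP_mul_left x y r⟩ :
    Fq[X] →* ℂ) x s

end ResidueSymbol

section GaussSum

variable {Fq : Type*} [Field Fq] [Fintype Fq]

/-- The quadratic Gauss sum `Σ_{|x|<|r|} ψ(a x² / r)`. -/
def quadGauss (e : AddChar Fq ℂ) (r a : Fq[X]) : ℂ :=
  ∑ x : Fin r.natDegree → Fq, fracChar e r (a * polyOf x ^ 2)

lemma gaussP_eq_quadGauss (e : AddChar Fq ℂ) (r : Fq[X]) : gaussP e r = quadGauss e r 1 := by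
  simp only [gaussP, quadGauss, fracChar_apply, one_mul, sq]

lemma quadGauss_mul_of_isCoprime (e : AddChar Fq ℂ) {r s : Fq[X]} (hr : r ≠ 0) (hs : s ≠ 0)
    (hrs : IsCoprime r s) (a : Fq[X]) :
    quadGauss e (r * s) a = quadGauss e r (a * s) * quadGauss e s (a * r) := by
  have h0 : r * s ≠ 0 := mul_ne_zero hr hs
  rw [quadGauss, sum_polyOf_eq_sum h0
    (fun i : (Fin r.natDegree → Fq) × (Fin s.natDegree → Fq) => s * polyOf i.1 + r * polyOf i.2)
    (by simp [natDegree_mul hr hs, pow_add]) ?_ (fun x => fracChar e (r * s) (a * x ^ 2)) ?_,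
    quadGauss, quadGauss, Fintype.sum_mul_sum, Fintype.sum_prod_type]
  · refine Finset.sum_congr rfl fun x _ => Finset.sum_congr rfl fun y _ => ?_
    have h : a * (s * polyOf x + r * polyOf y) ^ 2 =
        s * (a * s * polyOf x ^ 2) + r * (a * r * polyOf y ^ 2) +
          r * s * (2 * a * polyOf x * polyOf y) := by ring
    rw [h, AddChar.map_add_eq_mul, AddChar.map_add_eq_mul,
      fracChar_of_dvd e h0 (dvd_mul_right _ _), fracChar_mul_mul e hr, mul_comm r s,
      fracChar_mul_mul e hs, mul_one]
  · rintro ⟨x, y⟩ ⟨x', y'⟩ h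
    have h' : r * s ∣ s * (polyOf x - polyOf x') + r * (polyOf y - polyOf y') := by
      convert h using 1; ring
    refine Prod.ext (eq_of_dvd_polyOf_sub hr ?_) (eq_of_dvd_polyOf_sub hs ?_)
    · exact hrs.dvd_of_dvd_mul_left
        ((dvd_add_left (dvd_mul_right _ _)).1 ((dvd_mul_right r s).trans h'))
    · exact hrs.symm.dvd_of_dvd_mul_left
        ((dvd_add_right (dvd_mul_right _ _)).1 ((dvd_mul_left s r).trans h'))
  · intro x y h
    refine fracChar_congr e h0 ?_
    rw [← mul_sub, sq_sub_sq]
    exact (h.mul_left _).mul_left _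

lemma isUnit_two {K : Type*} [Field K] (h2 : (2 : K) ≠ 0) : IsUnit (2 : K[X]) := by
  rw [← map_ofNat C 2]
  exact isUnit_C.2 (isUnit_iff_ne_zero.2 h2)

lemma quadGauss_sq_mul {e : AddChar Fq ℂ} (he : e ≠ 1) (h2 : (2 : Fq) ≠ 0) {p s a : Fq[X]}
    (hp : Irreducible p) (hs : s ≠ 0) (ha : IsCoprime a p) :
    quadGauss e (p * (p * s)) a = (Fintype.card Fq : ℂ) ^ p.natDegree * quadGauss e s a := by
  have hp0 := hp.ne_zero
  have hps : p * s ≠ 0 := mul_ne_zero hp0 hs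
  have h0 : p * (p * s) ≠ 0 := mul_ne_zero hp0 hps
  have h2' := isUnit_two h2
  rw [quadGauss, sum_polyOf_eq_sum h0
    (fun i : (Fin s.natDegree → Fq) × (Fin p.natDegree → Fq) × (Fin p.natDegree → Fq) =>
      polyOf i.2.1 + p * polyOf i.1 + p * s * polyOf i.2.2)
    (by simp [natDegree_mul hp0 hps, natDegree_mul hp0 hs, pow_add]; ring) ?_
    (fun x => fracChar e (p * (p * s)) (a * x ^ 2)) ?_,
    quadGauss, Fintype.sum_prod_type, Finset.mul_sum]
  · refine Finset.sum_congr rfl fun w _ => ?_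
    have key : ∀ u z : Fin p.natDegree → Fq,
        fracChar e (p * (p * s)) (a * (polyOf u + p * polyOf w + p * s * polyOf z) ^ 2) =
        fracChar e (p * (p * s)) (a * (polyOf u + p * polyOf w) ^ 2) *
          fracChar e p (2 * a * polyOf u * polyOf z) := by
      intro u z
      have h : a * (polyOf u + p * polyOf w + p * s * polyOf z) ^ 2 =
          a * (polyOf u + p * polyOf w) ^ 2 + (p * s) * (2 * a * polyOf u * polyOf z) +
            p * (p * s) * (a * (2 * polyOf w * polyOf z + s * polyOf z ^ 2)) := by ring
      rw [h, AddChar.map_add_eq_mul, AddChar.map_add_eq_mul,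
        fracChar_of_dvd e h0 (dvd_mul_right _ _), mul_one]
      congr 1
      rw [mul_comm p (p * s), fracChar_mul_mul e hps]
    rw [Fintype.sum_prod_type]
    simp only [key, ← Finset.mul_sum]
    rw [Finset.sum_eq_single 0]
    · have h : a * (p * polyOf w) ^ 2 = p * (p * (a * polyOf w ^ 2)) := by ring
      have hz : polyOf (0 : Fin p.natDegree → Fq) = 0 := by simp [polyOf]
      simp [hz, h, fracChar_mul_mul e hp0, mul_comm]
    · intro u _ hu
      rw [sum_fracChar_mul_eq_zero he hp.natDegree_pos, mul_zero]
      refine ((isCoprime_mul_unit_left_left h2' _ _).2 ha).mul_left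
        ((hp.coprime_iff_not_dvd.2 fun h => hu ?_).symm)
      refine eq_of_dvd_polyOf_sub hp0 ?_
      simpa [polyOf] using h
    · simp
  · rintro ⟨w, u, z⟩ ⟨w', u', z'⟩ h
    have h' : p * (p * s) ∣ (polyOf u - polyOf u') +
        p * ((polyOf w - polyOf w') + s * (polyOf z - polyOf z')) := by
      convert h using 1; ring
    obtain rfl : u = u' := eq_of_dvd_polyOf_sub hp0
      ((dvd_add_left (dvd_mul_right _ _)).1 ((dvd_mul_right p _).trans h'))
    rw [sub_self, zero_add] at h'
    have h'' := (mul_dvd_mul_iff_left hp0).1 h'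
    obtain rfl : w = w' := eq_of_dvd_polyOf_sub hs
      ((dvd_add_left (dvd_mul_right _ _)).1 ((dvd_mul_left s p).trans h''))
    rw [sub_self, zero_add, mul_comm p] at h''
    rw [eq_of_dvd_polyOf_sub hp0 ((mul_dvd_mul_iff_left hs).1 h'')]
  · intro x y h
    refine fracChar_congr e h0 ?_
    rw [← mul_sub, sq_sub_sq]
    exact (h.mul_left _).mul_left _

lemma quadGauss_of_irreducible {e : AddChar Fq ℂ} (he : e ≠ 1) (h2 : (2 : Fq) ≠ 0)
    {p a : Fq[X]} (hp : Irreducible p) (ha : IsCoprime a p) :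
    quadGauss e p a = residueSymbol p a * quadGauss e p 1 := by
  have hp0 := hp.ne_zero
  have := Fact.mk hp
  have := finite_adjoinRoot hp0
  have := Fintype.ofFinite (AdjoinRoot p)
  have hchar : ringChar (AdjoinRoot p) ≠ 2 := fun h => by
    have hz : ((2 : ℕ) : AdjoinRoot p) = 0 := (ringChar.spec _ _).2 (by rw [h])
    have hz' : algebraMap Fq (AdjoinRoot p) 2 = 0 := by rw [map_ofNat]; exact_mod_cast hz
    exact h2 ((map_eq_zero _).1 hz')
  let ψ : AddChar (AdjoinRoot p) ℂ :=
    { toFun := fun k => fracChar e p (Function.surjInv AdjoinRoot.mk_surjective k)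
      map_zero_eq_one' := fracChar_of_dvd e hp0
        (AdjoinRoot.mk_eq_zero.1 (Function.surjInv_eq AdjoinRoot.mk_surjective 0))
      map_add_eq_mul' := fun k l => by
        rw [← AddChar.map_add_eq_mul]
        refine fracChar_congr e hp0 (AdjoinRoot.mk_eq_mk.1 ?_)
        simp only [map_add, Function.surjInv_eq AdjoinRoot.mk_surjective] }
  have hψ : ∀ b, ψ (AdjoinRoot.mk p b) = fracChar e p b := fun b =>
    fracChar_congr e hp0
      (AdjoinRoot.mk_eq_mk.1 (Function.surjInv_eq AdjoinRoot.mk_surjective _))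
  have hψ1 : ψ ≠ 1 := by
    obtain ⟨b, hb⟩ := exists_fracChar_ne_one he hp.natDegree_pos
    exact AddChar.ne_one_iff.2 ⟨AdjoinRoot.mk p b, by rwa [hψ]⟩
  have hbij : Function.Bijective
      fun x : Fin p.natDegree → Fq => AdjoinRoot.mk p (polyOf x) := by
    refine ⟨fun x y h => eq_of_dvd_polyOf_sub hp0 (AdjoinRoot.mk_eq_mk.1 h), fun k => ?_⟩
    obtain ⟨b, rfl⟩ := AdjoinRoot.mk_surjective k
    obtain ⟨x, hx⟩ := exists_dvd_sub_polyOf hp0 b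
    exact ⟨x, (AdjoinRoot.mk_eq_mk.2 hx).symm⟩
  let χ : MulChar (AdjoinRoot p) ℂ :=
    (quadraticChar (AdjoinRoot p)).ringHomComp (Int.castRingHom ℂ)
  have hχ : ∀ k, χ k = ((quadraticChar (AdjoinRoot p) k : ℤ) : ℂ) := fun _ => rfl
  have hsum : ∀ b, IsCoprime b p → quadGauss e p b =
      gaussSum χ (AddChar.mulShift ψ (AdjoinRoot.mk p b)) := by
    intro b hb
    have hb0 : AdjoinRoot.mk p b ≠ 0 := fun h =>
      hp.coprime_iff_not_dvd.1 hb.symm (AdjoinRoot.mk_eq_zero.1 h)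
    set k := AdjoinRoot.mk p b with hk
    have hzero : ∑ y, AddChar.mulShift ψ k y = 0 := by
      refine AddChar.sum_eq_zero_of_ne_one fun h => hψ1 ?_
      ext x
      have := DFunLike.congr_fun h (k⁻¹ * x)
      rwa [AddChar.mulShift_apply, mul_inv_cancel_left₀ hb0] at this
    calc quadGauss e p b = ∑ x : AdjoinRoot p, AddChar.mulShift ψ k (x ^ 2) := by
          refine Fintype.sum_bijective _ hbij _ _ fun x => ?_
          rw [AddChar.mulShift_apply, hk, ← map_pow, ← map_mul, hψ]
      _ = ∑ y, ∑ x with x ^ 2 = y, AddChar.mulShift ψ k (x ^ 2) :=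
          (Finset.sum_fiberwise _ _ _).symm
      _ = ∑ y, (χ y + 1) * AddChar.mulShift ψ k y := by
          refine Finset.sum_congr rfl fun y _ => ?_
          rw [Finset.sum_congr rfl fun x hx => by rw [(Finset.mem_filter.1 hx).2],
            Finset.sum_const, nsmul_eq_mul]
          congr 1
          have := quadraticChar_card_sqrts hchar y
          rw [hχ, ← Int.cast_one, ← Int.cast_add, ← this, Int.cast_natCast]
          congr 2
          ext x
          simp
      _ = gaussSum χ (AddChar.mulShift ψ k) := by
          simp only [add_mul, one_mul, Finset.sum_add_distrib, hzero, add_zero, gaussSum]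
  have ha0 : AdjoinRoot.mk p a ≠ 0 := fun h =>
    hp.coprime_iff_not_dvd.1 ha.symm (AdjoinRoot.mk_eq_zero.1 h)
  have hsq : residueSymbol p a * residueSymbol p a = 1 :=
    residueSymbol_mul_self (hp.coprime_iff_not_dvd.1 ha.symm)
  have hshift := gaussSum_mulShift χ ψ (Units.mk0 _ ha0)
  rw [Units.val_mk0, ← hsum a ha, hχ, ← residueSymbol_eq_quadraticChar] at hshift
  rw [hsum 1 isCoprime_one_left, map_one, AddChar.mulShift_one, ← hshift, ← mul_assoc, hsq,
    one_mul]

lemma quadGauss_eq_jacobiP_mul {e : AddChar Fq ℂ} (he : e ≠ 1) (h2 : (2 : Fq) ≠ 0)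
    {r : Fq[X]} (hr : r ≠ 0) {a : Fq[X]} (ha : IsCoprime a r) :
    quadGauss e r a = jacobiP a r * quadGauss e r 1 := by
  induction hn : r.natDegree using Nat.strong_induction_on generalizing r a with
  | _ n ih =>
  by_cases hu : IsUnit r
  · have h : ∀ b, quadGauss e r b = Fintype.card Fq ^ r.natDegree := fun b => by
      rw [quadGauss, Finset.sum_congr rfl fun x _ => fracChar_of_dvd e hr hu.dvd]
      simp
    rw [h, h, jacobiP_of_isUnit a hu, one_mul]
  obtain ⟨p, hp, s, rfl⟩ := WfDvdMonoid.exists_irreducible_factor hu hr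
  have hp0 := hp.ne_zero
  have hs : s ≠ 0 := right_ne_zero_of_mul hr
  have hdeg := hp.natDegree_pos
  rw [natDegree_mul hp0 hs] at hn
  have hap : IsCoprime a p := ha.of_mul_right_left
  have has : IsCoprime a s := ha.of_mul_right_right
  by_cases hps : p ∣ s
  · obtain ⟨s, rfl⟩ := hps
    have hs' : s ≠ 0 := right_ne_zero_of_mul hs
    rw [natDegree_mul hp0 hs'] at hn
    rw [quadGauss_sq_mul he h2 hp hs' hap, quadGauss_sq_mul he h2 hp hs' isCoprime_one_left,
      jacobiP_mul_right a hp0 hs, jacobiP_mul_right a hp0 hs', ← mul_assoc (jacobiP a p),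
      jacobiP_of_irreducible a hp, residueSymbol_mul_self (hp.coprime_iff_not_dvd.1 hap.symm),
      ih _ (by omega) hs' has.of_mul_right_right rfl]
    ring
  · have hc : IsCoprime p s := hp.coprime_iff_not_dvd.2 hps
    rw [quadGauss_mul_of_isCoprime e hp0 hs hc, quadGauss_mul_of_isCoprime e hp0 hs hc,
      quadGauss_of_irreducible he h2 hp (hap.mul_left hc.symm),
      quadGauss_of_irreducible he h2 hp (isCoprime_one_left.mul_left hc.symm),
      ih _ (by omega) hs (has.mul_left hc) rfl,
      ih _ (by omega) hs (isCoprime_one_left.mul_left hc) rfl,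
      jacobiP_mul_right a hp0 hs, jacobiP_of_irreducible a hp, residueSymbol_mul hp,
      jacobiP_mul_left, one_mul, one_mul]
    ring

end GaussSum

lemma addChar_map_sum {A M ι : Type*} [AddCommMonoid A] [CommMonoid M] (χ : AddChar A M)
    (s : Finset ι) (f : ι → A) : χ (∑ i ∈ s, f i) = ∏ i ∈ s, χ (f i) :=
  map_prod χ.toMonoidHom (fun i => Multiplicative.ofAdd (f i)) s

section CompletingTheSquare

lemma neg_mul_sq_eq_of_inverses {R : Type*} [CommRing R] {A A' α i2 i4 : R} (hA : A' * A = 1)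
    (hi2 : i2 * (2 * α) = 1) (hi4 : i4 * (4 * α) = 1) (c c' : R) :
    -(A * α * (A' * i2 * (A * c' - c)) ^ 2) =
      i2 * c * c' - A * (i4 * c' ^ 2) - A' * (i4 * c ^ 2) := by
  obtain rfl : i4 = i2 ^ 2 * α := by
    linear_combination i2 ^ 2 * α * hi4 - i4 * (2 * α * i2 + 1) * hi2
  linear_combination (-α * i2 ^ 2 * (A' * (A * c' - c) ^ 2 + A * c' ^ 2 - 2 * c * c')) * hA +
    i2 * c * c' * hi2

variable {Fq : Type*} [Field Fq]

lemma mk_modInv_mul_cancel {x r : Fq[X]} (h : IsCoprime x r) :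
    AdjoinRoot.mk r (modInv x r) * AdjoinRoot.mk r x = 1 := by
  rw [modInv, dif_pos h, ← map_mul, ← map_one (AdjoinRoot.mk r), AdjoinRoot.mk_eq_mk]
  obtain ⟨b, hb⟩ := h.choose_spec
  exact ⟨-b, by linear_combination hb⟩

lemma sum_fracChar_quadratic [Fintype Fq] {e : AddChar Fq ℂ} (he : e ≠ 1) (h2 : (2 : Fq) ≠ 0)
    {r u l v : Fq[X]} (hr : r ≠ 0) (hu : IsCoprime u r) (hv : r ∣ l - 2 * u * v) :
    ∑ x : Fin r.natDegree → Fq, fracChar e r (u * polyOf x ^ 2 + l * polyOf x) =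
      fracChar e r (-(u * v ^ 2)) * (jacobiP u r * gaussP e r) := by
  have hx : ∀ x : Fin r.natDegree → Fq, fracChar e r (u * polyOf x ^ 2 + l * polyOf x) =
      fracChar e r (-(u * v ^ 2)) * fracChar e r (u * (1 * polyOf x + v) ^ 2) := by
    intro x
    rw [← AddChar.map_add_eq_mul]
    refine fracChar_congr e hr ?_
    convert hv.mul_right (polyOf x) using 1
    ring
  rw [Finset.sum_congr rfl fun x _ => hx x, ← Finset.mul_sum, gaussP_eq_quadGauss,
    ← quadGauss_eq_jacobiP_mul he h2 hr hu, quadGauss,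
    sum_polyOf_affine hr isCoprime_one_left v (fun y => fracChar e r (u * y ^ 2)) fun x y h => ?_]
  refine fracChar_congr e hr ?_
  rw [← mul_sub, sq_sub_sq]
  exact (h.mul_left _).mul_left _

end CompletingTheSquare

end FF

open FF in
/-- evaluation of complete quadratic sums.  Let `q` be odd,
`G(x) = Σ_j α_j x_j²` diagonal with each `α_j` invertible mod `r`.  Then
`S_r(G,c,c',e₀) = τ_r^d (D/r) ψ(Σ_j (2α_j)⁻¹ c_j c_j'/r) ·
Σ*_a (a/r)^d ψ((a(e₀ − Σ_j (4α_j)⁻¹ c_j'²) − ā Σ_j (4α_j)⁻¹ c_j²)/r)`,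
where `τ_r` is the Gauss sum, `D = Π_j α_j`, `(·/·)` the Jacobi symbol, and `ā` the inverse
of `a` mod `r`. -/
theorem quadSum_evaluation {Fq : Type*} [Field Fq] [Fintype Fq]
    (hq : Odd (Fintype.card Fq)) (e : AddChar Fq ℂ) (he : e ≠ 1) {d : ℕ}
    (α : Fin d → Polynomial Fq) (r : Polynomial Fq) (hr : r ≠ 0)
    (hα : ∀ j, IsCoprime (α j) r)
    (c c' : Fin d → Polynomial Fq) (e₀ : Polynomial Fq) :
    quadSum e (Matrix.diagonal α) r c c' e₀ =
      (gaussP e r) ^ d * jacobiP (∏ j, α j) r *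
        psi e (toK (∑ j, modInv (2 * α j) r * c j * c' j) / toK r) *
        ∑ a : Fin r.natDegree → Fq,
          if IsCoprime (polyOf a) r then
            (jacobiP (polyOf a) r) ^ d *
              psi e (toK (polyOf a * (e₀ - ∑ j, modInv (4 * α j) r * c' j ^ 2) -
                modInv (polyOf a) r * ∑ j, modInv (4 * α j) r * c j ^ 2) / toK r)
          else 0 := by
  have h2 : (2 : Fq) ≠ 0 := Ring.two_ne_zero fun h => by
    rw [FiniteField.even_card_iff_char_two] at h
    rw [Nat.odd_iff] at hq
    omega
  have h2α : ∀ j, IsCoprime (2 * α j) r := fun j =>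
    (isCoprime_mul_unit_left_left (isUnit_two h2) _ _).2 (hα j)
  have h4α : ∀ j, IsCoprime (4 * α j) r := fun j => by
    rw [show 4 * α j = 2 * (2 * α j) by ring]
    exact (isCoprime_mul_unit_left_left (isUnit_two h2) _ _).2 (h2α j)
  rw [quadSum, Finset.mul_sum]
  refine Finset.sum_congr rfl fun a _ => ?_
  by_cases ha : IsCoprime (polyOf a) r
  swap
  · simp [ha]
  simp only [if_pos ha, ← fracChar_apply]
  set A := polyOf a
  have hterm : ∀ j, ∑ x : Fin r.natDegree → Fq,
      fracChar e r (A * α j * polyOf x ^ 2 + (A * c' j - c j) * polyOf x) =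
      fracChar e r (modInv (2 * α j) r * c j * c' j - A * (modInv (4 * α j) r * c' j ^ 2) -
        modInv A r * (modInv (4 * α j) r * c j ^ 2)) *
        (jacobiP A r * jacobiP (α j) r * gaussP e r) := by
    intro j
    have hA := mk_modInv_mul_cancel ha
    have hi2 := mk_modInv_mul_cancel (h2α j)
    have hi4 := mk_modInv_mul_cancel (h4α j)
    simp only [map_mul, map_ofNat] at hi2 hi4
    rw [sum_fracChar_quadratic he h2 hr (ha.mul_left (hα j))
      (v := modInv A r * modInv (2 * α j) r * (A * c' j - c j)), jacobiP_mul_left]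
    · congr 1
      refine fracChar_congr e hr (AdjoinRoot.mk_eq_mk.1 ?_)
      simp only [map_mul, map_sub, map_neg, map_pow]
      exact neg_mul_sq_eq_of_inverses hA hi2 hi4 _ _
    · refine AdjoinRoot.mk_eq_mk.1 ?_
      simp only [map_mul, map_sub, map_ofNat]
      set i2 := AdjoinRoot.mk r (modInv (2 * α j) r)
      linear_combination (AdjoinRoot.mk r (c j) - AdjoinRoot.mk r A * AdjoinRoot.mk r (c' j)) *
        (2 * AdjoinRoot.mk r (α j) * i2 * hA + hi2)
  have hsplit : ∀ b : Fin d → Fin r.natDegree → Fq,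
      fracChar e r (A * ((∑ i, ∑ j, polyOf (b i) * Matrix.diagonal α i j * polyOf (b j)) +
        (∑ i, c' i * polyOf (b i)) + e₀) - ∑ i, c i * polyOf (b i)) =
      fracChar e r (A * e₀) * ∏ j,
        fracChar e r (A * α j * polyOf (b j) ^ 2 + (A * c' j - c j) * polyOf (b j)) := by
    intro b
    rw [← addChar_map_sum, ← AddChar.map_add_eq_mul]
    congr 1
    simp only [Matrix.diagonal_apply, mul_ite, ite_mul, mul_zero, zero_mul, Finset.sum_ite_eq,
      Finset.mem_univ, if_true, mul_add, Finset.mul_sum, sub_mul, Finset.sum_add_distrib,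
      Finset.sum_sub_distrib, mul_assoc]
    simp only [mul_left_comm _ (α _), sq]
    ring
  have hprod : ∑ b : Fin d → Fin r.natDegree → Fq, ∏ j,
      fracChar e r (A * α j * polyOf (b j) ^ 2 + (A * c' j - c j) * polyOf (b j)) =
      ∏ j, ∑ x : Fin r.natDegree → Fq,
        fracChar e r (A * α j * polyOf x ^ 2 + (A * c' j - c j) * polyOf x) := by
    rw [Finset.prod_univ_sum, Fintype.piFinset_univ]
  have hchar : fracChar e r (A * e₀) * ∏ j, fracChar e r
      (modInv (2 * α j) r * c j * c' j - A * (modInv (4 * α j) r * c' j ^ 2) -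
        modInv A r * (modInv (4 * α j) r * c j ^ 2)) =
      fracChar e r (∑ j, modInv (2 * α j) r * c j * c' j) *
        fracChar e r (A * (e₀ - ∑ j, modInv (4 * α j) r * c' j ^ 2) -
          modInv A r * ∑ j, modInv (4 * α j) r * c j ^ 2) := by
    rw [← addChar_map_sum, ← AddChar.map_add_eq_mul, ← AddChar.map_add_eq_mul]
    congr 1
    simp only [Finset.sum_sub_distrib, ← Finset.mul_sum]
    ring
  simp only [hsplit, ← Finset.mul_sum]
  rw [hprod, Finset.prod_congr rfl fun j _ => hterm j, Finset.prod_mul_distrib, ← mul_assoc,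
    hchar, Finset.prod_mul_distrib, Finset.prod_mul_distrib, Finset.prod_const,
    Finset.prod_const, Finset.card_univ, Fintype.card_fin, jacobiP_prod_left]
  ring
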